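/- arXiv:1702.02590 — 9 statements merged into one kernel-verified Lean document; each statement's English description precedes it below -/
import Mathlib

section
/- Let Ω be the set of all countable ordinals (the first uncountable ordinal ω₁) with its natural well-order, let Σ be the σ-algebra on Ω consisting of the countable subsets and their complements, and let P be the set function with P(X) = 0 when X is countable and P(X) = 1 when the complement of X is countable. Then P is a probability measure on Σ, every initial segment {y : y ≤ x} is measurable, and P{y : y ≤ x} = 0 for every x ∈ Ω. Consequently, the identity map f on Ω is a measurable map into an ordered measurable space with all initial segments measurable whose induced function f̂(x) = P{y : f(y) ≤ f(x)} is identically 0. -/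
open MeasureTheory

/-- The set of countable ordinals (the first uncountable ordinal ω₁), with its natural order. -/
abbrev Omega1 : Type 1 := {o : Ordinal // o.card ≤ Cardinal.aleph0}

/-- The σ-algebra of countable and co-countable sets. -/
@[reducible] def countableCocountable (α : Type*) : MeasurableSpace α where
  MeasurableSet' s := s.Countable ∨ sᶜ.Countable
  measurableSet_empty := Or.inl Set.countable_empty
  measurableSet_compl s h := by rwa [compl_compl, or_comm]
  measurableSet_iUnion f h := by
    by_cases hf : ∀ i, (f i).Countable
    · exact Or.inl (Set.countable_iUnion hf)
    · obtain ⟨i, hi⟩ := not_forall.mp hf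
      exact Or.inr (((h i).resolve_left hi).mono
        (Set.compl_subset_compl.mpr (Set.subset_iUnion f i)))

open Classical in
/-- The outer measure that is `0` on countable sets and `1` on all other sets. -/
noncomputable def uncountableOuterMeasure (α : Type*) : OuterMeasure α where
  measureOf s := if s.Countable then 0 else 1
  empty := if_pos Set.countable_empty
  mono {s t} hst := by
    by_cases ht : t.Countable
    · simp [ht, ht.mono hst]
    · rw [if_neg ht]
      split_ifs <;> simp
  iUnion_nat f _ := by
    by_cases hf : ∀ i, (f i).Countable
    · simp [Set.countable_iUnion hf]
    · obtain ⟨i, hi⟩ := not_forall.mp hf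
      refine le_trans ?_ (ENNReal.le_tsum i)
      rw [if_neg hi]
      split_ifs <;> simp

theorem uncountableOuterMeasure_of_countable {α : Type*} {s : Set α} (hs : s.Countable) :
    uncountableOuterMeasure α s = 0 :=
  if_pos hs

theorem uncountableOuterMeasure_of_not_countable {α : Type*} {s : Set α} (hs : ¬ s.Countable) :
    uncountableOuterMeasure α s = 1 :=
  if_neg hs

theorem isCaratheodory_uncountableOuterMeasure_of_countable {α : Type*} {s : Set α}
    (hs : s.Countable) : (uncountableOuterMeasure α).IsCaratheodory s := by
  rw [OuterMeasure.isCaratheodory_iff_le']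
  intro t
  rw [uncountableOuterMeasure_of_countable (hs.mono Set.inter_subset_right), zero_add]
  exact measure_mono Set.sdiff_subset

theorem countableCocountable_le_caratheodory (α : Type*) :
    countableCocountable α ≤ (uncountableOuterMeasure α).caratheodory := by
  rintro s (hs | hs)
  · exact isCaratheodory_uncountableOuterMeasure_of_countable hs
  · exact (OuterMeasure.isCaratheodory_compl_iff _).mp
      (isCaratheodory_uncountableOuterMeasure_of_countable hs)

theorem countable_Iio_of_card_le_aleph0 {o : Ordinal} (ho : o.card ≤ Cardinal.aleph0) :
    (Set.Iio o).Countable := by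
  rw [← Cardinal.le_aleph0_iff_set_countable, Cardinal.mk_Iio_ordinal]
  rwa [Cardinal.lift_le_aleph0]

theorem countable_setOf_le_omega1 (x : Omega1) : {y : Omega1 | y ≤ x}.Countable := by
  have h : (Set.Iio (x.1 + 1)).Countable := by
    apply countable_Iio_of_card_le_aleph0
    rw [Ordinal.card_add_one]
    exact Cardinal.add_le_aleph0.mpr ⟨x.2, Cardinal.one_le_aleph0⟩
  refine (h.preimage Subtype.val_injective).mono fun y (hy : y ≤ x) => ?_
  exact Order.lt_add_one_iff.mpr (Subtype.coe_le_coe.mpr hy)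

theorem not_countable_univ_omega1 : ¬ (Set.univ : Set Omega1).Countable := by
  intro h
  have h' : (Set.Iio (Order.succ Cardinal.aleph0.{0}).ord).Countable := by
    refine (h.image Subtype.val).mono fun o ho => ?_
    exact ⟨⟨o, Order.lt_succ_iff.mp (Cardinal.lt_ord.mp ho)⟩, trivial, rfl⟩
  rw [← Cardinal.le_aleph0_iff_set_countable, Cardinal.mk_Iio_ordinal, Cardinal.card_ord,
    Cardinal.lift_le_aleph0] at h'
  exact (Order.lt_succ Cardinal.aleph0).not_ge h'

theorem stmt0 :
    ∃ (Sig : MeasurableSpace Omega1) (P : @Measure Omega1 Sig),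
      (∀ s : Set Omega1, MeasurableSet[Sig] s ↔ s.Countable ∨ sᶜ.Countable) ∧
      @IsProbabilityMeasure Omega1 Sig P ∧
      (∀ s : Set Omega1, s.Countable → P s = 0) ∧
      (∀ s : Set Omega1, sᶜ.Countable → P s = 1) ∧
      (∀ x : Omega1, MeasurableSet[Sig] {y | y ≤ x}) ∧
      (∀ x : Omega1, P {y | id y ≤ id x} = 0) := by
  let _ := countableCocountable Omega1
  let P : Measure Omega1 :=
    (uncountableOuterMeasure Omega1).toMeasure (countableCocountable_le_caratheodory Omega1)
  have hzero (s : Set Omega1) (hs : s.Countable) : P s = 0 := by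
    have hm : MeasurableSet s := Or.inl hs
    rw [toMeasure_apply _ _ hm, uncountableOuterMeasure_of_countable hs]
  have hone (s : Set Omega1) (hs : sᶜ.Countable) : P s = 1 := by
    have hm : MeasurableSet s := Or.inr hs
    rw [toMeasure_apply _ _ hm, uncountableOuterMeasure_of_not_countable]
    intro h
    exact not_countable_univ_omega1 (Set.union_compl_self s ▸ h.union hs)
  refine ⟨countableCocountable Omega1, P, fun _ => Iff.rfl, ⟨hone _ (by simp)⟩, hzero, hone,
    fun x => Or.inl (countable_setOf_le_omega1 x), fun x => hzero _ (countable_setOf_le_omega1 x)⟩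
end

section
/- For a linear order R, the following are equivalent: (1) R is ω₁-short, i.e., there is no order embedding of ω₁ into R; (2) every nonempty subset X of R contains a nondecreasing sequence x₁ ≤ x₂ ≤ ⋯ that is cofinal with X (meaning every element of X is ≤ some xₙ). -/
theorem Ordinal.card_le_aleph0_iff_lt_omega_one {o : Ordinal} :
    o.card ≤ Cardinal.aleph0 ↔ o < Ordinal.omega 1 := by
  rw [← Cardinal.ord_aleph, Cardinal.lt_ord, ← Cardinal.succ_aleph0, Order.lt_succ_iff]

theorem Omega1.exists_forall_lt (a : ℕ → Omega1) : ∃ b : Omega1, ∀ n, a n < b := by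
  have h : ⨆ n, Order.succ (a n).1 < Ordinal.omega 1 :=
    Ordinal.iSup_lt_omega_one fun n =>
      (Cardinal.isSuccLimit_omega 1).succ_lt
        (Ordinal.card_le_aleph0_iff_lt_omega_one.1 (a n).2)
  refine ⟨⟨_, Ordinal.card_le_aleph0_iff_lt_omega_one.2 h⟩, fun n => ?_⟩
  exact (Order.lt_succ (a n).1).trans_le
    (Ordinal.le_iSup (fun n => Order.succ (a n).1) n)

theorem Omega1.countable_Iio (a : Omega1) : (Set.Iio a).Countable := by
  have h : (Set.Iio a.1).Countable := by
    rw [← Cardinal.le_aleph0_iff_set_countable, Cardinal.mk_Iio_ordinal,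
      Cardinal.lift_le_aleph0]
    exact a.2
  exact (h.preimage Subtype.val_injective).mono fun _ hb => hb

/-- If every countable subset of a linear order has a strict upper bound, then `ω₁` embeds. -/
theorem Omega1.nonempty_orderEmbedding {α : Type*} [LinearOrder α]
    (h : ∀ S : Set α, S.Countable → ∃ y, ∀ s ∈ S, s < y) : Nonempty (Omega1 ↪o α) := by
  have h' : ∀ S : Set α, ∃ y, S.Countable → ∀ s ∈ S, s < y := fun S => by
    by_cases hS : S.Countable
    · exact (h S hS).imp fun _ hy _ => hy
    · exact ⟨(h ∅ Set.countable_empty).choose, fun hc => absurd hc hS⟩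
  choose g hg using h'
  let f : Omega1 → α :=
    (wellFounded_lt (α := Omega1)).fix fun a F => g (Set.range fun b : Set.Iio a => F b b.2)
  have hf (a : Omega1) : f a = g (Set.range fun b : Set.Iio a => f b) :=
    WellFounded.fix_eq _ _ a
  refine ⟨OrderEmbedding.ofStrictMono f fun b a hba => ?_⟩
  have := (Omega1.countable_Iio a).to_subtype
  rw [hf a]
  exact hg _ (Set.countable_range _) _ ⟨⟨b, hba⟩, rfl⟩

theorem stmt1 (R : Type*) [LinearOrder R] :
    (¬ Nonempty (Omega1 ↪o R)) ↔
      ∀ X : Set R, X.Nonempty →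
        ∃ x : ℕ → R, (∀ n, x n ∈ X) ∧ Monotone x ∧ ∀ y ∈ X, ∃ n, y ≤ x n := by
  constructor
  · intro hR X hX
    by_contra hseq
    have : Nonempty X := hX.to_subtype
    obtain ⟨e⟩ : Nonempty (Omega1 ↪o X) := by
      refine Omega1.nonempty_orderEmbedding fun S hS => ?_
      by_contra! hbound
      obtain ⟨s₀, hs₀, -⟩ := hbound hX.to_subtype.some
      obtain ⟨u, rfl⟩ := hS.exists_eq_range ⟨s₀, hs₀⟩
      refine hseq ⟨fun n => partialSups u n, fun n => (partialSups u n).2,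
        fun m n hmn => (partialSups u).monotone hmn, fun y hy => ?_⟩
      obtain ⟨_, ⟨n, rfl⟩, hn⟩ := hbound ⟨y, hy⟩
      exact ⟨n, hn.trans (le_partialSups u n)⟩
    exact hR ⟨e.trans (OrderEmbedding.subtype _)⟩
  · rintro h ⟨e⟩
    obtain ⟨x, hx, -, hcof⟩ := h (Set.range e) ⟨_, ⟨0, by simp⟩, rfl⟩
    choose a ha using hx
    obtain ⟨b, hb⟩ := Omega1.exists_forall_lt a
    obtain ⟨n, hn⟩ := hcof (e b) ⟨b, rfl⟩
    rw [← ha n, e.le_iff_le] at hn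
    exact (hb n).not_ge hn
end

section
/- Let (Ω, Σ, P) be a probability space, let R be a short linear order equipped with a σ-algebra containing all initial segments (-∞, r], and let f : Ω → R be measurable. Define f̂ : Ω → [0,1] by f̂(x) = P{y : f(y) ≤ f(x)}. Then f̂ is measurable and is self-induced: for every x ∈ Ω, P{y : f̂(y) ≤ f̂(x)} = f̂(x). -/
open MeasureTheory

theorem countable_Iio_omega1 (o : Omega1) : (Set.Iio o).Countable := by
  have h : (Set.Iio (o : Ordinal.{0})).Countable := by
    rw [← Cardinal.le_aleph0_iff_set_countable, Cardinal.mk_Iio_ordinal,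
      Cardinal.lift_le_aleph0]
    exact o.2
  exact h.preimage Subtype.val_injective

/-- A linear order in which every countable set has a strict upper bound contains a copy
of `ω₁`. -/
theorem nonempty_omega1_orderEmbedding {S : Type*} [LinearOrder S]
    (h : ∀ C : Set S, C.Countable → ∃ a, ∀ c ∈ C, c < a) : Nonempty (Omega1 ↪o S) := by
  have : Nonempty S := (h ∅ Set.countable_empty).nonempty
  choose! u hu using h
  let g : Omega1 → S := (wellFounded_lt (α := Omega1)).fix
    fun o ih => u (Set.range fun p : Set.Iio o => ih p.1 p.2)
  have hg (o : Omega1) : g o = u (Set.range fun p : Set.Iio o => g p.1) :=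
    WellFounded.fix_eq _ _ _
  refine ⟨OrderEmbedding.ofStrictMono g fun a b hab => ?_⟩
  rw [hg b]
  have := (countable_Iio_omega1 b).to_subtype
  exact hu _ (Set.countable_range _) _ ⟨⟨a, hab⟩, rfl⟩

theorem exists_countable_cofinal_subset {R : Type*} [LinearOrder R]
    (h : ¬ Nonempty (Omega1 ↪o R)) (A : Set R) :
    ∃ C ⊆ A, C.Countable ∧ ∀ a ∈ A, ∃ c ∈ C, a ≤ c := by
  by_contra! hA
  refine h ?_
  obtain ⟨e⟩ : Nonempty (Omega1 ↪o A) := by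
    refine nonempty_omega1_orderEmbedding fun C hC => ?_
    obtain ⟨a, ha, hlt⟩ := hA (Subtype.val '' C) (by simp) (hC.image _)
    exact ⟨⟨a, ha⟩, fun c hc => hlt c ⟨c, hc, rfl⟩⟩
  exact ⟨e.trans (OrderEmbedding.subtype _)⟩

theorem IsLowerSet.exists_countable_biUnion_Iic {R : Type*} [LinearOrder R]
    (h : ¬ Nonempty (Omega1 ↪o R)) {A : Set R} (hA : IsLowerSet A) :
    ∃ C ⊆ A, C.Countable ∧ A = ⋃ c ∈ C, Set.Iic c := by
  obtain ⟨C, hCA, hC, hcof⟩ := exists_countable_cofinal_subset h A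
  refine ⟨C, hCA, hC, Set.Subset.antisymm (fun a ha => ?_) ?_⟩
  · simpa using hcof a ha
  · exact Set.iUnion₂_subset fun c hc a hac => hA hac (hCA hc)

theorem stmt6 {Ω : Type*} [MeasurableSpace Ω] (P : Measure Ω) [IsProbabilityMeasure P]
    (R : Type*) [LinearOrder R] [MeasurableSpace R]
    (hshort₁ : ¬ Nonempty (Omega1 ↪o R)) (hshort₂ : ¬ Nonempty (Omega1ᵒᵈ ↪o R))
    (hIic : ∀ r : R, MeasurableSet (Set.Iic r))
    (f : Ω → R) (hf : Measurable f) :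
    Measurable (fun x => (P {y | f y ≤ f x}).toReal) ∧
    ∀ x : Ω,
      (P {y | (P {z | f z ≤ f y}).toReal ≤ (P {z | f z ≤ f x}).toReal}).toReal
        = (P {y | f y ≤ f x}).toReal := by
  have hmono : Monotone fun r => (P {z | f z ≤ r}).toReal := fun r s hrs =>
    ENNReal.toReal_mono (measure_ne_top P _) (measure_mono fun z hz => le_trans hz hrs)
  have hlow (c : ℝ) : IsLowerSet {r | (P {z | f z ≤ r}).toReal ≤ c} :=
    fun r s hsr hr => (hmono hsr).trans hr
  constructor
  · refine Measurable.comp (g := fun r => (P {z | f z ≤ r}).toReal)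
      (measurable_of_Iic fun c => ?_) hf
    obtain ⟨C, -, hC, hEq⟩ := (hlow c).exists_countable_biUnion_Iic hshort₁
    change MeasurableSet {r | (P {z | f z ≤ r}).toReal ≤ c}
    rw [hEq]
    exact MeasurableSet.biUnion hC fun r _ => hIic r
  · intro x
    obtain ⟨C, hCA, hC, hEq⟩ :=
      (hlow (P {z | f z ≤ f x}).toReal).exists_countable_biUnion_Iic hshort₁
    congr 1
    refine le_antisymm ?_ (measure_mono fun y hy => hmono hy)
    have hpre : {y | (P {z | f z ≤ f y}).toReal ≤ (P {z | f z ≤ f x}).toReal}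
        = ⋃ c ∈ C, {z | f z ≤ c} := by
      have := congrArg (f ⁻¹' ·) hEq
      rwa [Set.preimage_iUnion₂] at this
    have hdir : DirectedOn (Function.onFun (· ⊆ ·) fun c => {z | f z ≤ c}) C := by
      intro a ha b hb
      rcases le_total a b with hab | hab
      · exact ⟨b, hb, fun z hz => le_trans hz hab, subset_rfl⟩
      · exact ⟨a, ha, subset_rfl, fun z hz => le_trans hz hab⟩
    rw [hpre, measure_biUnion_eq_iSup hC hdir]
    exact iSup₂_le fun c hc =>
      (ENNReal.toReal_le_toReal (measure_ne_top P _) (measure_ne_top P _)).1 (hCA hc)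
end

section
/- A linear order can be order-embedded into the real line ℝ if and only if its order topology is second countable. -/
/-- A linear order with a countable set meeting every interval `[x, y)` embeds into `ℝ`. -/
theorem nonempty_orderEmbedding_real_of_countable {R : Type*} [LinearOrder R] {C : Set R}
    (hC : C.Countable) (h : ∀ x y, x < y → ∃ c ∈ C, x ≤ c ∧ c < y) : Nonempty (R ↪o ℝ) := by
  have := hC.to_subtype
  obtain ⟨e, he⟩ := exists_injective_nat C
  have hs : Summable fun c : C => (1 / 2 : ℝ) ^ e c :=
    summable_geometric_two.comp_injective he
  have hs' (x : R) : Summable ({c : C | (c : R) < x}.indicator fun c => (1 / 2 : ℝ) ^ e c) :=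
    hs.indicator _
  refine ⟨OrderEmbedding.ofStrictMono
    (fun x => ∑' c, {c : C | (c : R) < x}.indicator (fun c => (1 / 2 : ℝ) ^ e c) c) ?_⟩
  intro x y hxy
  obtain ⟨c, hc, hxc, hcy⟩ := h x y hxy
  refine (hs' x).tsum_lt_tsum (i := ⟨c, hc⟩) (fun d => ?_) ?_ (hs' y)
  · have hsub : {c : C | (c : R) < x} ⊆ {c : C | (c : R) < y} := fun _ hd => lt_trans hd hxy
    exact Set.indicator_le_indicator_of_subset hsub (fun _ => by positivity) d
  · simp [hcy, hxc]

/-- A suborder of `ℝ` has a countable set meeting every interval `[x, y)` and `(x, y]`. -/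
theorem exists_countable_of_orderEmbedding_real {R : Type*} [LinearOrder R] (f : R ↪o ℝ) :
    ∃ C : Set R, C.Countable ∧
      ∀ x y, x < y → (∃ c ∈ C, x ≤ c ∧ c < y) ∧ ∃ c ∈ C, x < c ∧ c ≤ y := by
  classical
  have hD (p : ℚ × ℚ) : ∃ s : Set R, s.Countable ∧
      ∀ w, (p.1 : ℝ) < f w → f w < p.2 → ∃ r ∈ s, (p.1 : ℝ) < f r ∧ f r < p.2 := by
    by_cases hp : ∃ w, (p.1 : ℝ) < f w ∧ f w < p.2
    · obtain ⟨w, hw⟩ := hp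
      exact ⟨{w}, Set.countable_singleton w, fun _ _ _ => ⟨w, rfl, hw⟩⟩
    · exact ⟨∅, Set.countable_empty, fun w h₁ h₂ => (hp ⟨w, h₁, h₂⟩).elim⟩
  choose D hDc hD using hD
  refine ⟨(⋃ p, D p) ∪ {x | ∃ z, f x < z ∧ ∀ y, x < y → z ≤ f y} ∪
    {x | ∃ z, z < f x ∧ ∀ y, y < x → f y ≤ z}, ?_, fun x y hxy => ?_⟩
  · exact ((Set.countable_iUnion hDc).union (countable_image_lt_image_Ioi f)).union
      (countable_image_lt_image_Iio f)
  by_cases hw : ∃ w, x < w ∧ w < y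
  · obtain ⟨w, hxw, hwy⟩ := hw
    obtain ⟨p, hxp, hpw⟩ := exists_rat_btwn (f.lt_iff_lt.2 hxw)
    obtain ⟨q, hwq, hqy⟩ := exists_rat_btwn (f.lt_iff_lt.2 hwy)
    obtain ⟨r, hr, hpr, hrq⟩ := hD (p, q) w hpw hwq
    have hxr : x < r := f.lt_iff_lt.1 (hxp.trans hpr)
    have hry : r < y := f.lt_iff_lt.1 (hrq.trans hqy)
    have hrC := Set.mem_iUnion.2 ⟨(p, q), hr⟩
    exact ⟨⟨r, .inl (.inl hrC), hxr.le, hry⟩, ⟨r, .inl (.inl hrC), hxr, hry.le⟩⟩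
  · push Not at hw
    have hw' (z : R) (hz : z < y) : z ≤ x := le_of_not_gt fun h => (hw z h).not_gt hz
    exact ⟨⟨x, .inl (.inr ⟨f y, f.lt_iff_lt.2 hxy, fun z hz => f.le_iff_le.2 (hw z hz)⟩),
      le_rfl, hxy⟩, ⟨y, .inr ⟨f x, f.lt_iff_lt.2 hxy, fun z hz => f.le_iff_le.2 (hw' z hz)⟩,
      hxy, le_rfl⟩⟩

/-- The order topology is second countable if a countable set meets every interval `[x, y)` and
`(x, y]`. -/
theorem secondCountableTopology_of_countable {R : Type*} [LinearOrder R] [TopologicalSpace R]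
    [OrderTopology R] {C : Set R} (hC : C.Countable)
    (h : ∀ x y, x < y → (∃ c ∈ C, x ≤ c ∧ c < y) ∧ ∃ c ∈ C, x < c ∧ c ≤ y) :
    SecondCountableTopology R := by
  refine ⟨⟨Set.Ioi '' C ∪ Set.Iio '' C, (hC.image _).union (hC.image _), le_antisymm ?_ ?_⟩⟩
  · refine le_generateFrom ?_
    rintro _ (⟨c, -, rfl⟩ | ⟨c, -, rfl⟩)
    exacts [isOpen_Ioi, isOpen_Iio]
  · rw [OrderTopology.topology_eq_generate_intervals (α := R)]
    refine le_generateFrom ?_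
    rintro _ ⟨a, rfl | rfl⟩
    · have : Set.Ioi a = ⋃ c ∈ C ∩ Set.Ici a, Set.Ioi c := by
        ext y
        simp only [Set.mem_Ioi, Set.mem_iUnion, exists_prop]
        refine ⟨fun hy => ?_, fun ⟨c, hc, hcy⟩ => lt_of_le_of_lt hc.2 hcy⟩
        obtain ⟨c, hc, hac, hcy⟩ := (h a y hy).1
        exact ⟨c, ⟨hc, hac⟩, hcy⟩
      rw [this]
      let _ := TopologicalSpace.generateFrom (Set.Ioi '' C ∪ Set.Iio '' C)
      exact isOpen_biUnion fun c hc => .basic _ (.inl ⟨c, hc.1, rfl⟩)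
    · have : Set.Iio a = ⋃ c ∈ C ∩ Set.Iic a, Set.Iio c := by
        ext y
        simp only [Set.mem_Iio, Set.mem_iUnion, exists_prop]
        refine ⟨fun hy => ?_, fun ⟨c, hc, hcy⟩ => lt_of_lt_of_le hcy hc.2⟩
        obtain ⟨c, hc, hyc, hca⟩ := (h y a hy).2
        exact ⟨c, ⟨hc, hca⟩, hyc⟩
      rw [this]
      let _ := TopologicalSpace.generateFrom (Set.Ioi '' C ∪ Set.Iio '' C)
      exact isOpen_biUnion fun c hc => .basic _ (.inr ⟨c, hc.1, rfl⟩)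

/-- A second countable linear order has a countable set meeting every interval `[x, y)`. -/
theorem exists_countable_of_secondCountableTopology (R : Type*) [LinearOrder R]
    [TopologicalSpace R] [OrderTopology R] [SecondCountableTopology R] :
    ∃ C : Set R, C.Countable ∧ ∀ x y, x < y → ∃ c ∈ C, x ≤ c ∧ c < y := by
  obtain ⟨D, hDc, hD⟩ := TopologicalSpace.exists_countable_dense R
  refine ⟨D ∪ {x | ∃ y, x ⋖ y}, hDc.union countable_setOfPred_covBy_right, fun x y hxy => ?_⟩
  by_cases hw : (Set.Ioo x y).Nonempty
  · obtain ⟨d, hd, hdD⟩ := hD.inter_open_nonempty _ isOpen_Ioo hw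
    exact ⟨d, .inl hdD, hd.1.le, hd.2⟩
  · exact ⟨x, .inr ⟨y, hxy, fun z hxz hzy => hw ⟨z, hxz, hzy⟩⟩, le_rfl, hxy⟩

theorem stmt11 (R : Type*) [LinearOrder R] [TopologicalSpace R] [OrderTopology R] :
    Nonempty (R ↪o ℝ) ↔ SecondCountableTopology R := by
  constructor
  · rintro ⟨f⟩
    obtain ⟨C, hC, h⟩ := exists_countable_of_orderEmbedding_real f
    exact secondCountableTopology_of_countable hC h
  · intro _
    obtain ⟨C, hC, h⟩ := exists_countable_of_secondCountableTopology R
    exact nonempty_orderEmbedding_real_of_countable hC h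
end

section
/- Let R be a linear order with second-countable order topology and let g : R → ℝ be an order embedding. Then g is measurable with respect to the p-minimal σ-algebra on R and the Borel σ-algebra on ℝ; indeed, the preimage under g of every initial segment (-∞, t] of ℝ is a countable union of initial segments (-∞, r] of R. -/
/-- The p-minimal σ-algebra on a linear order: the least σ-algebra containing all
initial segments `(-∞, r]`. -/
def pMinimal (R : Type*) [LinearOrder R] : MeasurableSpace R :=
  MeasurableSpace.generateFrom {s : Set R | ∃ r, s = Set.Iic r}

/-- A lower set in a linear order with second-countable order topology is a countable union of
closed initial segments. -/
theorem IsLowerSet.exists_countable_sUnion_Iic {R : Type*} [LinearOrder R] [TopologicalSpace R]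
    [OrderTopology R] [SecondCountableTopology R] {A : Set R} (hA : IsLowerSet A) :
    ∃ C : Set (Set R), C.Countable ∧ (∀ s ∈ C, ∃ r : R, s = Set.Iic r) ∧ A = ⋃₀ C := by
  by_cases hmax : ∃ r, IsGreatest A r
  · obtain ⟨r, hr, hub⟩ := hmax
    refine ⟨{Set.Iic r}, Set.countable_singleton _, fun s hs => ⟨r, hs⟩, ?_⟩
    rw [Set.sUnion_singleton]
    exact Set.Subset.antisymm hub fun x hx => hA hx hr
  · obtain ⟨T, hTA, hT, hU⟩ := TopologicalSpace.isOpen_biUnion_countable A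
      (fun a : R => Set.Iio a) fun _ _ => isOpen_Iio
    refine ⟨Set.Iic '' T, hT.image _, ?_, ?_⟩
    · rintro _ ⟨r, -, rfl⟩
      exact ⟨r, rfl⟩
    · rw [Set.sUnion_image]
      refine Set.Subset.antisymm (fun x hx => ?_)
        (Set.iUnion₂_subset fun a ha x hx => hA hx (hTA ha))
      have hlt : ∃ y ∈ A, x < y := by
        by_contra! h
        exact hmax ⟨x, hx, h⟩
      obtain ⟨y, hy, hxy⟩ := hlt
      have hmem : x ∈ ⋃ a ∈ T, Set.Iio a := hU ▸ Set.mem_biUnion hy hxy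
      exact Set.biUnion_mono subset_rfl (fun a _ => Set.Iio_subset_Iic_self) hmem

theorem stmt12 (R : Type*) [LinearOrder R] [TopologicalSpace R] [OrderTopology R]
    [SecondCountableTopology R] (g : R ↪o ℝ) :
    (∀ t : ℝ, ∃ C : Set (Set R), C.Countable ∧ (∀ s ∈ C, ∃ r : R, s = Set.Iic r) ∧
      g ⁻¹' (Set.Iic t) = ⋃₀ C) ∧
    @Measurable R ℝ (pMinimal R) _ g := by
  have key : ∀ t : ℝ, ∃ C : Set (Set R), C.Countable ∧ (∀ s ∈ C, ∃ r : R, s = Set.Iic r) ∧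
      g ⁻¹' (Set.Iic t) = ⋃₀ C := fun t =>
    ((isLowerSet_Iic t).preimage g.monotone).exists_countable_sUnion_Iic
  refine ⟨key, ?_⟩
  let _ : MeasurableSpace R := pMinimal R
  refine measurable_of_Iic fun t => ?_
  obtain ⟨C, hC, hCr, heq⟩ := key t
  rw [heq]
  exact MeasurableSet.sUnion hC fun s hs => MeasurableSpace.measurableSet_generateFrom (hCr s hs)
end

section
/- Let (Ω, Σ, P) be a probability space, let R be a short linear order equipped with a σ-algebra containing all initial segments (-∞, r], and let f : Ω → R be measurable with atomless pushforward measure P∘f⁻¹. Define f̂(x) = P{y : f(y) ≤ f(x)}. Then f̂ is diffuse: P{x : f̂(x) = ε} = 0 for every ε ∈ [0,1]. -/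
open MeasureTheory

/-- An atom of a measure: a measurable set of positive measure that cannot be split into
two disjoint measurable sets of positive measure. -/
def IsMeasureAtom {α : Type*} [MeasurableSpace α] (P : Measure α) (A : Set α) : Prop :=
  MeasurableSet A ∧ 0 < P A ∧
    ¬ ∃ B C : Set α, MeasurableSet B ∧ MeasurableSet C ∧ Disjoint B C ∧ B ∪ C = A ∧
      0 < P B ∧ 0 < P C

open Set in
/-- The order `Omega1` embeds into every linear order having a subset of uncountable cofinality. -/
theorem exists_countable_cofinal {R : Type*} [LinearOrder R]
    (h : ¬ Nonempty (Omega1 ↪o R)) (S : Set R) :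
    ∃ C ⊆ S, C.Countable ∧ ∀ x ∈ S, ∃ c ∈ C, x ≤ c := by
  by_contra hC
  have key : ∀ C : Set R, ∃ b : R, C ⊆ S → C.Countable → b ∈ S ∧ ∀ c ∈ C, c < b := by
    intro C
    by_cases hS : C ⊆ S ∧ C.Countable
    · by_contra hb
      refine hC ⟨C, hS.1, hS.2, fun x hx => ?_⟩
      by_contra hx'
      push Not at hx'
      exact hb ⟨x, fun _ _ => ⟨hx, hx'⟩⟩
    · obtain ⟨x⟩ : Nonempty R := by
        by_contra hR
        rw [not_nonempty_iff] at hR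
        exact hC ⟨∅, empty_subset _, countable_empty, fun x => hR.elim x⟩
      exact ⟨x, fun h₁ h₂ => (hS ⟨h₁, h₂⟩).elim⟩
  choose b hb using key
  have hwf : WellFounded ((· < ·) : Omega1 → Omega1 → Prop) := wellFounded_lt
  let g : Omega1 → R := hwf.fix fun o ih => b (range fun p : Iio o => ih p.1 p.2)
  have hg : ∀ o, g o = b (range fun p : Iio o => g p.1) := fun o => hwf.fix_eq _ o
  have hcount : ∀ o : Omega1, Countable (Iio o) := by
    intro o
    have : Countable (Iio o.1) := by
      rw [← Cardinal.mk_le_aleph0_iff, Cardinal.mk_Iio_ordinal, Cardinal.lift_le_aleph0]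
      exact o.2
    exact Function.Injective.countable (f := fun p : Iio o => (⟨p.1.1, p.2⟩ : Iio o.1))
      fun p q hpq => Subtype.ext (Subtype.ext (Subtype.mk.inj hpq))
  have hgS : ∀ o, g o ∈ S := by
    intro o
    induction o using hwf.induction with
    | _ o ih =>
      have := hcount o
      rw [hg]
      exact (hb _ (range_subset_iff.2 fun p : Iio o => ih p.1 p.2) (countable_range _)).1
  have hmono : StrictMono g := by
    intro p o hpo
    have := hcount o
    rw [hg o]
    exact (hb _ (range_subset_iff.2 fun q : Iio o => hgS q.1) (countable_range _)).2 _
      (mem_range_self (⟨p, hpo⟩ : Iio o))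
  exact h ⟨OrderEmbedding.ofStrictMono g hmono⟩

theorem exists_countable_coinitial {R : Type*} [LinearOrder R]
    (h : ¬ Nonempty (Omega1ᵒᵈ ↪o R)) (S : Set R) :
    ∃ C ⊆ S, C.Countable ∧ ∀ x ∈ S, ∃ c ∈ C, c ≤ x :=
  exists_countable_cofinal (R := Rᵒᵈ) (fun ⟨e⟩ => h ⟨e.dual⟩) S

theorem measurableSet_Iio_of_measurableSet_Iic {R : Type*} [LinearOrder R] [MeasurableSpace R]
    (h : ¬ Nonempty (Omega1 ↪o R)) (hIic : ∀ r : R, MeasurableSet (Set.Iic r)) (r : R) :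
    MeasurableSet (Set.Iio r) := by
  obtain ⟨C, hCS, hC, hcof⟩ := exists_countable_cofinal h (Set.Iio r)
  have : Set.Iio r = ⋃ c ∈ C, Set.Iic c := by
    ext x
    simp only [Set.mem_iUnion, Set.mem_Iic, exists_prop]
    exact ⟨hcof x, fun ⟨c, hc, hxc⟩ => hxc.trans_lt (hCS hc)⟩
  rw [this]
  exact .biUnion hC fun c _ => hIic c

/-- A measurable singleton of positive measure is an atom. -/
theorem isMeasureAtom_singleton {α : Type*} [MeasurableSpace α] {P : Measure α} {a : α}
    (ha : MeasurableSet {a}) (hpos : 0 < P {a}) : IsMeasureAtom P {a} := by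
  refine ⟨ha, hpos, ?_⟩
  rintro ⟨B, C, -, -, hBC, hU, hB, hC⟩
  obtain ⟨x, hx⟩ := nonempty_of_measure_ne_zero hB.ne'
  obtain ⟨y, hy⟩ := nonempty_of_measure_ne_zero hC.ne'
  have hxa : x = a := hU.subset (.inl hx)
  have hya : y = a := hU.subset (.inr hy)
  exact Set.disjoint_left.1 hBC hx (hxa.trans hya.symm ▸ hy)

theorem stmt14 {Ω : Type*} [MeasurableSpace Ω] (P : Measure Ω) [IsProbabilityMeasure P]
    (R : Type*) [LinearOrder R] [MeasurableSpace R]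
    (hshort₁ : ¬ Nonempty (Omega1 ↪o R)) (hshort₂ : ¬ Nonempty (Omega1ᵒᵈ ↪o R))
    (hIic : ∀ r : R, MeasurableSet (Set.Iic r))
    (f : Ω → R) (hf : Measurable f)
    (hdiffuse : ¬ ∃ A : Set R, IsMeasureAtom (P.map f) A) :
    ∀ ε ∈ Set.Icc (0:ℝ) 1, P {x | (P {y | f y ≤ f x}).toReal = ε} = 0 := by
  intro ε _
  have hsing : ∀ a, P (f ⁻¹' {a}) = 0 := by
    intro a
    have ha : MeasurableSet {a} := by
      rw [← Set.Iic_sdiff_Iio_same]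
      exact (hIic a).diff (measurableSet_Iio_of_measurableSet_Iic hshort₁ hIic a)
    rw [← Measure.map_apply hf ha]
    by_contra h
    exact hdiffuse ⟨_, isMeasureAtom_singleton ha (pos_iff_ne_zero.2 h)⟩
  let S : Set R := {r | (P (f ⁻¹' Set.Iic r)).toReal = ε}
  have hIoc : ∀ a ∈ S, ∀ b ∈ S, P (f ⁻¹' Set.Ioc a b) = 0 := by
    intro a ha b hb
    rcases le_total a b with hab | hab
    · have hPab : P (f ⁻¹' Set.Iic b) = P (f ⁻¹' Set.Iic a) :=
        (ENNReal.toReal_eq_toReal_iff' (measure_ne_top _ _) (measure_ne_top _ _)).1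
          (hb.trans ha.symm)
      rw [← Set.Iic_sdiff_Iic, Set.preimage_sdiff,
        measure_sdiff (Set.preimage_mono (Set.Iic_subset_Iic.2 hab))
          (hf (hIic a)).nullMeasurableSet (measure_ne_top _ _), hPab, tsub_self]
    · simp [Set.Ioc_eq_empty hab.not_gt]
  obtain ⟨C, hCS, hC, hcof⟩ := exists_countable_cofinal hshort₁ S
  obtain ⟨D, hDS, hD, hcoi⟩ := exists_countable_coinitial hshort₂ S
  have hnull : P (⋃ d ∈ D, ⋃ c ∈ C, f ⁻¹' {d} ∪ f ⁻¹' Set.Ioc d c) = 0 :=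
    (measure_biUnion_null_iff hD).2 fun d hd => (measure_biUnion_null_iff hC).2 fun c hc =>
      measure_union_null (hsing d) (hIoc d (hDS hd) c (hCS hc))
  refine measure_mono_null (fun x hx => ?_) hnull
  obtain ⟨c, hc, hxc⟩ := hcof (f x) hx
  obtain ⟨d, hd, hdx⟩ := hcoi (f x) hx
  refine Set.mem_biUnion hd (Set.mem_biUnion hc ?_)
  rcases hdx.eq_or_lt with h | h
  · exact .inl h.symm
  · exact .inr ⟨h, hxc⟩
end

section
/- Let Ω be the set of countable ordinals equipped with the reverse of its natural well-order (so α < β iff β ∈ α as ordinals), let Σ be the σ-algebra of countable subsets of Ω and their complements, and let P be the probability measure with P(X) = 0 for countable X and P(X) = 1 otherwise. Let R be a linear order equipped with its p-minimal σ-algebra and let η : Ω → R be an order embedding. Then η is measurable, P(η⁻¹{r}) = 0 for every r ∈ R, and the induced function η̂(x) = P{y : η(y) ≤ η(x)} satisfies η̂(x) = 1 for every x; in particular η̂ is not an exact p-function. -/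
open MeasureTheory

/-- Proper final segments of the reversed order on the countable ordinals are countable. -/
theorem countable_Ioi_dual_Omega1 (x : Omega1ᵒᵈ) : (Set.Ioi x).Countable := by
  have hx : (Set.Iio (OrderDual.ofDual x).1).Countable := by
    rw [← Cardinal.le_aleph0_iff_set_countable, Cardinal.mk_Iio_ordinal,
      Cardinal.lift_le_aleph0]
    exact (OrderDual.ofDual x).2
  refine (hx.preimage (f := fun y : Omega1ᵒᵈ => (OrderDual.ofDual y).1) ?_).mono ?_
  · exact Subtype.val_injective.comp OrderDual.ofDual.injective
  · intro y hy
    exact hy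

/-- A lower set in the reversed order on the countable ordinals is countable or cocountable. -/
theorem IsLowerSet.countable_or_countable_compl {s : Set Omega1ᵒᵈ} (hs : IsLowerSet s) :
    s.Countable ∨ sᶜ.Countable := by
  rcases s.eq_empty_or_nonempty with rfl | ⟨x, hx⟩
  · exact Or.inl Set.countable_empty
  · refine Or.inr ((countable_Ioi_dual_Omega1 x).mono fun y hy => ?_)
    exact lt_of_not_ge fun hyx => hy (hs hyx hx)

theorem stmt16 (R : Type*) [LinearOrder R]
    (Sig : MeasurableSpace Omega1ᵒᵈ) (P : @Measure Omega1ᵒᵈ Sig)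
    (hSig : ∀ s : Set Omega1ᵒᵈ, MeasurableSet[Sig] s ↔ s.Countable ∨ sᶜ.Countable)
    (hprob : @IsProbabilityMeasure Omega1ᵒᵈ Sig P)
    (hzero : ∀ s : Set Omega1ᵒᵈ, s.Countable → P s = 0)
    (hone : ∀ s : Set Omega1ᵒᵈ, sᶜ.Countable → P s = 1)
    (η : Omega1ᵒᵈ ↪o R) :
    @Measurable Omega1ᵒᵈ R Sig (pMinimal R) η ∧
    (∀ r : R, P (η ⁻¹' {r}) = 0) ∧
    (∀ x : Omega1ᵒᵈ, P {y | η y ≤ η x} = 1) ∧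
    ¬ (∀ ε ∈ Set.Icc (0:ℝ) 1,
        (P {x | (P {y | η y ≤ η x}).toReal ≤ ε}).toReal = ε) := by
  have h_one : ∀ x : Omega1ᵒᵈ, P {y | η y ≤ η x} = 1 := fun x => by
    refine hone _ ((countable_Ioi_dual_Omega1 x).mono fun y hy => ?_)
    exact lt_of_not_ge fun hyx => hy (η.monotone hyx)
  refine ⟨?_, fun r => ?_, h_one, fun h => ?_⟩
  · refine @measurable_generateFrom _ _ Sig _ _ ?_
    rintro _ ⟨r, rfl⟩
    exact (hSig _).2 ((isLowerSet_Iic r).preimage η.monotone).countable_or_countable_compl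
  · exact hzero _ ((Set.countable_singleton r).preimage η.injective)
  · have h_half := h (1 / 2) (by norm_num)
    simp only [h_one, ENNReal.toReal_one] at h_half
    norm_num at h_half
end

section
/- If R and S are short linear orders, then the product R × S with the lexicographic order ((p,r) ≤ (q,s) iff p < q, or p = q and r ≤ s) is a short linear order. -/
theorem Omega1.countable_Iio_s17 (a : Omega1) : Countable {b : Omega1 // b < a} := by
  have h : Countable (Set.Iio a.1) := by
    rw [← Cardinal.mk_le_aleph0_iff, Cardinal.mk_Iio_ordinal, Cardinal.lift_le_aleph0]
    exact a.2
  refine Function.Injective.countable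
    (f := fun b : {b : Omega1 // b < a} => (⟨b.1.1, b.2⟩ : Set.Iio a.1)) ?_
  intro b c hbc
  exact Subtype.ext (Subtype.ext (Subtype.mk.inj hbc))

theorem Omega1.lt_omega_one (a : Omega1) : a.1 < Ordinal.omega 1 := by
  rw [← Cardinal.ord_aleph, Cardinal.lt_ord]
  exact a.2.trans_lt Cardinal.aleph0_lt_aleph_one

theorem Omega1.exists_upper_bound {ι : Type*} [Countable ι] (h : ι → Omega1) :
    ∃ c : Omega1, ∀ i, h i ≤ c := by
  have hlt : ⨆ i, (h i).1 < Ordinal.omega 1 :=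
    Ordinal.iSup_lt_omega_one fun i => (h i).lt_omega_one
  rw [← Cardinal.ord_aleph, Cardinal.lt_ord, ← Cardinal.succ_aleph0, Order.lt_succ_iff] at hlt
  exact ⟨⟨_, hlt⟩, fun i => Ordinal.le_iSup (fun i => (h i).1) i⟩

/-- A monotone map on the countable ordinals that is not eventually constant has a strictly
increasing restriction to a copy of the countable ordinals. -/
theorem Omega1.exists_strictMono_of_forall_exists_lt {R : Type*} [Preorder R] {p : Omega1 → R}
    (hp : Monotone p) (h : ∀ a, ∃ b, p a < p b) : ∃ g : Omega1 → R, StrictMono g := by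
  have key : ∀ (a : Omega1) (k : ∀ b, b < a → Omega1),
      ∃ c, ∀ b (hb : b < a), p (k b hb) < p c := by
    intro a k
    have := a.countable_Iio_s17
    obtain ⟨d, hd⟩ := exists_upper_bound fun b : {b : Omega1 // b < a} => k b.1 b.2
    obtain ⟨c, hc⟩ := h d
    exact ⟨c, fun b hb => (hp (hd ⟨b, hb⟩)).trans_lt hc⟩
  choose F hF using key
  have wf : WellFounded (fun a b : Omega1 => a < b) := wellFounded_lt
  refine ⟨fun a => p (wf.fix F a), fun a b hab => ?_⟩
  have := hF b (fun c _ => wf.fix F c) a hab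
  rwa [← wf.fix_eq F b] at this

/-- Shift of the countable ordinals by a countable ordinal. -/
theorem Omega1.exists_strictMono_ge (a : Omega1) :
    ∃ g : Omega1 → Omega1, StrictMono g ∧ ∀ b, a ≤ g b := by
  refine ⟨fun b => ⟨a.1 + b.1, ?_⟩, fun b c hbc => ?_, fun b => ?_⟩
  · rw [Ordinal.card_add]
    exact Cardinal.add_le_aleph0.2 ⟨a.2, b.2⟩
  · exact (add_lt_add_iff_left a.1).2 hbc
  · exact le_self_add (a := a.1) (b := b.1)

theorem Omega1.exists_strictMono_of_strictMono_toLex {R S : Type*} [PartialOrder R] [Preorder S]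
    {p : Omega1 → R} {s : Omega1 → S}
    (h : ∀ a b, a < b → p a < p b ∨ p a = p b ∧ s a < s b) :
    (∃ g : Omega1 → R, StrictMono g) ∨ ∃ g : Omega1 → S, StrictMono g := by
  have hp : Monotone p := monotone_iff_forall_lt.2 fun a b hab =>
    (h a b hab).elim le_of_lt fun h => h.1.le
  by_cases hc : ∀ a, ∃ b, p a < p b
  · exact .inl (exists_strictMono_of_forall_exists_lt hp hc)
  · push Not at hc
    obtain ⟨a, ha⟩ := hc
    obtain ⟨g, hg, hag⟩ := a.exists_strictMono_ge
    refine .inr ⟨s ∘ g, fun b c hbc => ?_⟩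
    refine ((h _ _ (hg hbc)).resolve_left fun hlt => ?_).2
    exact ha (g c) ((hp (hag b)).trans_lt hlt)

theorem stmt17 (R S : Type*) [LinearOrder R] [LinearOrder S]
    (hR₁ : ¬ Nonempty (Omega1 ↪o R)) (hR₂ : ¬ Nonempty (Omega1ᵒᵈ ↪o R))
    (hS₁ : ¬ Nonempty (Omega1 ↪o S)) (hS₂ : ¬ Nonempty (Omega1ᵒᵈ ↪o S)) :
    ¬ Nonempty (Omega1 ↪o (R ×ₗ S)) ∧ ¬ Nonempty (Omega1ᵒᵈ ↪o (R ×ₗ S)) := by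
  constructor
  · rintro ⟨f⟩
    obtain ⟨g, hg⟩ | ⟨g, hg⟩ := Omega1.exists_strictMono_of_strictMono_toLex
      (p := fun a => (ofLex (f a)).1) (s := fun a => (ofLex (f a)).2)
      fun a b hab => Prod.Lex.lt_iff.1 (f.lt_iff_lt.2 hab)
    · exact hR₁ ⟨OrderEmbedding.ofStrictMono g hg⟩
    · exact hS₁ ⟨OrderEmbedding.ofStrictMono g hg⟩
  · rintro ⟨f⟩
    obtain ⟨g, hg⟩ | ⟨g, hg⟩ := Omega1.exists_strictMono_of_strictMono_toLex
      (p := fun a => OrderDual.toDual (ofLex (f (OrderDual.toDual a))).1)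
      (s := fun a => OrderDual.toDual (ofLex (f (OrderDual.toDual a))).2)
      fun a b hab => (Prod.Lex.lt_iff.1 (f.lt_iff_lt.2 (OrderDual.toDual_lt_toDual.2 hab))).imp
        id fun h => ⟨congrArg OrderDual.toDual h.1.symm, h.2⟩
    · exact hR₂ ⟨OrderEmbedding.ofStrictMono (fun a => OrderDual.ofDual (g (OrderDual.ofDual a)))
        fun a b hab => hg hab⟩
    · exact hS₂ ⟨OrderEmbedding.ofStrictMono (fun a => OrderDual.ofDual (g (OrderDual.ofDual a)))
        fun a b hab => hg hab⟩
end

section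
/- Let (Ω, Σ, P) be a probability space and f : Ω → ℝ a Borel-measurable function. On the product probability space (Ω × [0,1], Σ ⊗ B, P × U), where B is the Borel σ-algebra on [0,1] and U the uniform (Lebesgue) probability measure, define F(x, r) = (f(x), r) with values in ℝ × [0,1] ordered lexicographically, and let F̂(x, r) = (P × U){(y, s) : (f(y), s) ≤ₗₑₓ (f(x), r)}. Then F̂ is an exact p-function: (P × U){(x, r) : F̂(x, r) ≤ ε} = ε for every ε ∈ [0,1]. -/
open MeasureTheory

/-- The mass of an initial segment of the lexicographic order, cut at level `c` along `S`. -/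
lemma prod_real_lex_segment {Ω : Type*} [MeasurableSpace Ω] (P : Measure Ω)
    [IsProbabilityMeasure P] {f : Ω → ℝ} (hf : Measurable f) (c : ℝ)
    {S : Set (Set.Icc (0:ℝ) 1)} (hS : MeasurableSet S) :
    (P.prod (volume : Measure (Set.Icc (0:ℝ) 1))).real
        {q : Ω × Set.Icc (0:ℝ) 1 | f q.1 < c ∨ f q.1 = c ∧ q.2 ∈ S}
      = (P.map f).real (Set.Iio c) + (P.map f).real {c} * volume.real S := by
  have hset : {q : Ω × Set.Icc (0:ℝ) 1 | f q.1 < c ∨ f q.1 = c ∧ q.2 ∈ S}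
      = (f ⁻¹' Set.Iio c) ×ˢ Set.univ ∪ (f ⁻¹' {c}) ×ˢ S := by
    ext q
    simp
  have hm : MeasurableSet ((f ⁻¹' {c}) ×ˢ S) := (hf (measurableSet_singleton c)).prod hS
  rw [hset, measureReal_union _ hm, measureReal_prod_prod, measureReal_prod_prod,
    map_measureReal_apply hf measurableSet_Iio,
    map_measureReal_apply hf (measurableSet_singleton c), probReal_univ, mul_one]
  rw [Set.disjoint_left]
  rintro q ⟨hq, -⟩ ⟨hq', -⟩
  exact absurd hq' (ne_of_lt hq)

/-- The induced function of `(f, id)` in the lexicographic order, in closed form. -/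
lemma prod_real_lex_le {Ω : Type*} [MeasurableSpace Ω] (P : Measure Ω)
    [IsProbabilityMeasure P] {f : Ω → ℝ} (hf : Measurable f) (t : ℝ) (r : Set.Icc (0:ℝ) 1) :
    (P.prod (volume : Measure (Set.Icc (0:ℝ) 1))).real
        {q : Ω × Set.Icc (0:ℝ) 1 |
          toLex ((f q.1, q.2) : ℝ × Set.Icc (0:ℝ) 1) ≤ toLex ((t, r) : ℝ × Set.Icc (0:ℝ) 1)}
      = (P.map f).real (Set.Iio t) + (P.map f).real {t} * r := by
  have h := prod_real_lex_segment P hf t (measurableSet_Iic (a := r))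
  have hr : (volume : Measure (Set.Icc (0:ℝ) 1)).real (Set.Iic r) = r := by
    rw [measureReal_def, unitInterval.volume_Iic, ENNReal.toReal_ofReal r.2.1]
  rw [hr] at h
  rw [← h]
  congr 1
  ext q
  simp [Prod.Lex.toLex_le_toLex]

/-- A probability measure on the line has, at each level strictly between `0` and `1`, a largest
quantile. -/
lemma exists_quantile (μ : Measure ℝ) [IsProbabilityMeasure μ] {ε : ℝ} (h0 : 0 < ε)
    (h1 : ε < 1) :
    ∃ c, (∀ t < c, μ.real (Set.Iic t) ≤ ε) ∧ (∀ t, c < t → ε < μ.real (Set.Iio t)) ∧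
      μ.real (Set.Iio c) ≤ ε ∧ ε ≤ μ.real (Set.Iic c) := by
  set F := ProbabilityTheory.cdf μ
  have hIic (t : ℝ) : μ.real (Set.Iic t) = F t := (ProbabilityTheory.cdf_eq_real μ t).symm
  have hbot := ProbabilityTheory.tendsto_cdf_atBot μ
  have htop := ProbabilityTheory.tendsto_cdf_atTop μ
  have hIio (t : ℝ) : μ.real (Set.Iio t) = Function.leftLim F t := by
    conv_lhs => rw [← ProbabilityTheory.measure_cdf μ]
    rw [measureReal_def, StieltjesFunction.measure_Iio _ hbot, sub_zero, ENNReal.toReal_ofReal]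
    obtain ⟨s, hs⟩ := exists_lt t
    exact (ProbabilityTheory.cdf_nonneg μ s).trans (F.mono.le_leftLim hs)
  simp only [hIic, hIio]
  set A := {t : ℝ | Function.leftLim F t ≤ ε}
  have hne : A.Nonempty := by
    obtain ⟨t, ht⟩ := (hbot.eventually (gt_mem_nhds h0)).exists
    exact ⟨t, (F.mono.leftLim_le le_rfl).trans ht.le⟩
  have hbdd : BddAbove A := by
    obtain ⟨t, ht⟩ := (htop.eventually (lt_mem_nhds h1)).exists
    refine ⟨t, fun s hs => ?_⟩
    by_contra! hlt
    exact absurd (F.mono.le_leftLim hlt) (not_le.2 (lt_of_le_of_lt hs ht))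
  have hlt : ∀ t < sSup A, F t ≤ ε := fun t ht => by
    obtain ⟨s, hs, hts⟩ := exists_lt_of_lt_csSup hne ht
    exact (F.mono.le_leftLim hts).trans hs
  have hgt : ∀ t, sSup A < t → ε < Function.leftLim F t := fun t ht => by
    by_contra! h
    exact absurd (le_csSup hbdd h) (not_le.2 ht)
  refine ⟨sSup A, hlt, hgt, ?_, ?_⟩
  · exact le_of_tendsto (F.mono.tendsto_leftLim _) (eventually_nhdsWithin_of_forall hlt)
  · have hr := (F.right_continuous (sSup A)).mono Set.Ioi_subset_Ici_self
    exact ge_of_tendsto hr (eventually_nhdsWithin_of_forall fun t ht =>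
      ((hgt t ht).le.trans (F.mono.leftLim_le le_rfl)))

/-- The law of the induced function at levels strictly between `0` and `1`. -/
lemma prod_real_closed_form_le {Ω : Type*} [MeasurableSpace Ω] (P : Measure Ω)
    [IsProbabilityMeasure P] {f : Ω → ℝ} (hf : Measurable f) {ε : ℝ} (h0 : 0 < ε) (h1 : ε < 1) :
    (P.prod (volume : Measure (Set.Icc (0:ℝ) 1))).real
      {p : Ω × Set.Icc (0:ℝ) 1 |
        (P.map f).real (Set.Iio (f p.1)) + (P.map f).real {f p.1} * p.2 ≤ ε} = ε := by
  have : IsProbabilityMeasure (P.map f) := Measure.isProbabilityMeasure_map hf.aemeasurable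
  set μ := P.map f with hμ
  obtain ⟨c, hlt, hgt, hc1, hc2⟩ := exists_quantile μ h0 h1
  have hadd (t : ℝ) : μ.real (Set.Iic t) = μ.real (Set.Iio t) + μ.real {t} := by
    rw [← Set.Iio_union_right, measureReal_union (by simp) (measurableSet_singleton t)]
  set S := {r : Set.Icc (0:ℝ) 1 | μ.real (Set.Iio c) + μ.real {c} * r ≤ ε} with hS
  have hSm : MeasurableSet S := measurableSet_le (by fun_prop) measurable_const
  have hset : {p : Ω × Set.Icc (0:ℝ) 1 | μ.real (Set.Iio (f p.1)) + μ.real {f p.1} * p.2 ≤ ε}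
      = {q : Ω × Set.Icc (0:ℝ) 1 | f q.1 < c ∨ f q.1 = c ∧ q.2 ∈ S} := by
    ext ⟨x, r⟩
    have hn : 0 ≤ μ.real {f x} := measureReal_nonneg
    simp only [Set.mem_ofPred_eq, hS]
    rcases lt_trichotomy (f x) c with h | h | h
    · have := hlt _ h
      rw [hadd] at this
      refine iff_of_true ?_ (Or.inl h)
      nlinarith [r.2.2]
    · simp [h]
    · have := hgt _ h
      refine iff_of_false ?_ (by rintro (h' | ⟨h', -⟩) <;> linarith)
      nlinarith [mul_nonneg hn r.2.1]
  rw [hset, prod_real_lex_segment P hf c hSm, ← hμ]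
  rw [hadd] at hc2
  rcases (measureReal_nonneg : 0 ≤ μ.real {c}).eq_or_lt with h | h
  · rw [← h] at hc2 ⊢
    linarith
  · set q := (ε - μ.real (Set.Iio c)) / μ.real {c} with hq
    have hq0 : 0 ≤ q := div_nonneg (by linarith) h.le
    have hq1 : q ≤ 1 := (div_le_one h).2 (by linarith)
    have hSq : S = Set.Iic ⟨q, hq0, hq1⟩ := by
      ext r
      rw [Set.mem_Iic, ← Subtype.coe_le_coe, hS, Set.mem_ofPred_eq, le_div_iff₀ h]
      constructor <;> intro _ <;> linarith
    rw [hSq, measureReal_def volume, unitInterval.volume_Iic, ENNReal.toReal_ofReal hq0, hq]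
    field_simp
    ring

theorem stmt19 {Ω : Type*} [MeasurableSpace Ω] (P : Measure Ω) [IsProbabilityMeasure P]
    (f : Ω → ℝ) (hf : Measurable f) :
    ∀ ε ∈ Set.Icc (0:ℝ) 1,
      ((P.prod (volume : Measure (Set.Icc (0:ℝ) 1)))
        {p : Ω × Set.Icc (0:ℝ) 1 |
          ((P.prod (volume : Measure (Set.Icc (0:ℝ) 1)))
            {q : Ω × Set.Icc (0:ℝ) 1 |
              toLex ((f q.1, q.2) : ℝ × Set.Icc (0:ℝ) 1)
                ≤ toLex ((f p.1, p.2) : ℝ × Set.Icc (0:ℝ) 1)}).toReal ≤ ε}).toReal = ε := by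
  rintro ε ⟨h0, h1⟩
  rcases h1.eq_or_lt with rfl | h1
  · simp only [← measureReal_def, measureReal_le_one, Set.ofPred_true, probReal_univ]
  · simp only [← measureReal_def, prod_real_lex_le P hf]
    rcases h0.eq_or_lt with rfl | h0
    · refine le_antisymm (le_of_forall_gt_imp_ge_of_dense fun δ hδ => ?_) measureReal_nonneg
      have hm : 0 < min δ (1 / 2) := lt_min hδ (by norm_num)
      refine le_trans ?_ (min_le_left δ (1 / 2))
      rw [← prod_real_closed_form_le P hf hm (lt_of_le_of_lt (min_le_right _ _) (by norm_num))]
      exact measureReal_mono fun p (hp : _ ≤ _) => hp.trans hm.le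
    · exact prod_real_closed_form_le P hf h0 h1
end
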